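/- Value lower bounds for restricted safe strategies: let H₋ = (β₋^1,…,β₋^T) be a bid history, b* = ⟨(b*_1,q*_1),…,(b*_m,q*_m)⟩ an m-uniform strategy RoI-feasible for H₋ with cumulative quantities Q*_j, and r*_t = x(b*;β₋^t). For j ∈ {1,…,m} define T_j = {t : Q*_{j−1} < r*_t ≤ Q*_j}, T_{j,0} = {t ∈ T_j : r*_t < Q*_j}, T_{j,1} = {t ∈ T_j : r*_t = Q*_j}, Q̂_j = max{r*_t : t ∈ T_{j,0}} if T_{j,0} ≠ ∅ and Q̂_j = Q*_j otherwise, and σ_k = ∑_{i=1}^{k} v_i. Then for every j ∈ {1,…,m}: (a) if Q̂_j < Q*_j then ∑_{t ∈ T_j} V((w_{Q̂_j}, Q̂_j); β₋^t) ≥ ∑_{t ∈ T_{j,0}} V(b*;β₋^t) + σ_{Q̂_j}·|T_{j,1}|; and (b) ∑_{t ∈ T_j} V((w_{Q*_j}, Q*_j); β₋^t) ≥ σ_{Q*_j}·|T_{j,1}|. -/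

import Mathlib

open Finset

namespace Auction

/-- A competing-bid profile for an auction of `K` identical units, represented by the
function sending `j ∈ {1,…,K}` to the `j`-th smallest element of the multiset of the
`K` largest competing bids. -/
structure Profile (K : ℕ) where
  c : ℕ → ℝ
  mono : ∀ i j : ℕ, 1 ≤ i → i ≤ j → j ≤ K → c i ≤ c j
  nonneg : ∀ j : ℕ, 1 ≤ j → j ≤ K → 0 ≤ c j

/-- A bid vector: `n` units are demanded and `bid j` is the bid for the `j`-th unit
(for `1 ≤ j ≤ n`). -/
structure BidVec where
  n : ℕ
  bid : ℕ → ℝ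

/-- A bid vector is valid if its bids are non-increasing and positive. -/
def BidVec.Valid (b : BidVec) : Prop :=
  (∀ i j : ℕ, 1 ≤ i → i ≤ j → j ≤ b.n → b.bid j ≤ b.bid i) ∧
  ∀ j : ℕ, 1 ≤ j → j ≤ b.n → 0 < b.bid j

open Classical in
/-- The number of units the bidder wins (ties broken in the bidder's favor): the
largest `r ≤ min n K` such that the bidder's `j`-th bid is at least the `j`-th
threshold `β.c j` for every `j ≤ r`. -/
noncomputable def alloc (K : ℕ) (b : BidVec) (β : Profile K) : ℕ :=
  ((Finset.Icc 1 (min b.n K)).filter fun r => ∀ j ∈ Finset.Icc 1 r, β.c j ≤ b.bid j).sup id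

/-- The clearing price: the `K`-th highest among all submitted bids (taken to be `0`
when the bidder wins no unit). -/
noncomputable def price (K : ℕ) (b : BidVec) (β : Profile K) : ℝ :=
  if alloc K b β = 0 then 0
  else if alloc K b β < K then min (b.bid (alloc K b β)) (β.c (alloc K b β + 1))
  else b.bid K

/-- The value obtained by the bidder. -/
noncomputable def value (v : ℕ → ℝ) (K : ℕ) (b : BidVec) (β : Profile K) : ℝ :=
  ∑ j ∈ Finset.Icc 1 (alloc K b β), v j

/-- The bidder's total payment. -/
noncomputable def payment (K : ℕ) (b : BidVec) (β : Profile K) : ℝ :=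
  price K b β * (alloc K b β : ℝ)

/-- The RoI constraint (with target RoI `γ = 0`) against a single competing-bid profile. -/
def Feasible (v : ℕ → ℝ) (K : ℕ) (b : BidVec) (β : Profile K) : Prop :=
  payment K b β ≤ value v K b β

/-- A bid vector is safe if it satisfies the RoI constraint against every profile. -/
def Safe (v : ℕ → ℝ) (K : ℕ) (b : BidVec) : Prop :=
  ∀ β : Profile K, Feasible v K b β

/-- A valuation vector: nonnegative and non-increasing on `{1,…,M}`. -/
def ValidValuation (M : ℕ) (v : ℕ → ℝ) : Prop :=
  (∀ j : ℕ, 1 ≤ j → j ≤ M → 0 ≤ v j) ∧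
  ∀ i j : ℕ, 1 ≤ i → i ≤ j → j ≤ M → v j ≤ v i

/-- The average cumulative valuation `w_j = (v_1 + ⋯ + v_j) / j`. -/
noncomputable def w (v : ℕ → ℝ) (j : ℕ) : ℝ :=
  (∑ ℓ ∈ Finset.Icc 1 j, v ℓ) / (j : ℝ)

/-- An `m`-uniform bidding strategy: bid-quantity pairs `(b j, q j)` for `1 ≤ j ≤ m`. -/
structure Uniform where
  m : ℕ
  b : ℕ → ℝ
  q : ℕ → ℕ

/-- Cumulative quantities `Q j = q 1 + ⋯ + q j`. -/
def Uniform.Q (s : Uniform) (j : ℕ) : ℕ := ∑ ℓ ∈ Finset.Icc 1 j, s.q ℓ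

/-- `s` is a genuine `m`-uniform strategy for maximum demand `M`:
`b 1 > b 2 > ⋯ > b m > 0`, positive quantities, and `Q m ≤ M`. -/
def Uniform.IsUniform (M : ℕ) (s : Uniform) : Prop :=
  1 ≤ s.m ∧
  (∀ j : ℕ, 1 ≤ j → j ≤ s.m → 0 < s.q j) ∧
  0 < s.b s.m ∧
  (∀ j : ℕ, 1 ≤ j → j < s.m → s.b (j + 1) < s.b j) ∧
  s.Q s.m ≤ M

/-- The bid vector associated to a uniform strategy: the bid on the `j`-th unit is
`b ℓ`, where `ℓ` is least with `j ≤ Q ℓ`. -/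
noncomputable def Uniform.toBidVec (s : Uniform) : BidVec :=
  ⟨s.Q s.m, fun j => s.b (sInf {ℓ : ℕ | j ≤ s.Q ℓ})⟩

/-- The 1-uniform strategy bidding `b` on `q` units. -/
def single (b : ℝ) (q : ℕ) : Uniform := ⟨1, fun _ => b, fun _ => q⟩

/-- Membership in the class `𝒫*_{≤ m}` of safe undominated strategies with at most `m`
bid-quantity pairs: strategies determined by a tuple `0 < Q 1 < ⋯ < Q k ≤ M` (`k ≤ m`)
via `b ℓ = w (Q ℓ)` and `q ℓ = Q ℓ - Q (ℓ-1)`. -/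
def InSafeClass (M : ℕ) (v : ℕ → ℝ) (m : ℕ) (s : Uniform) : Prop :=
  1 ≤ s.m ∧ s.m ≤ m ∧ (∀ j : ℕ, 1 ≤ j → j ≤ s.m → 0 < s.q j) ∧ s.Q s.m ≤ M ∧
  ∀ ℓ : ℕ, 1 ≤ ℓ → ℓ ≤ s.m → s.b ℓ = w v (s.Q ℓ)

/-- Membership in the class `𝒬_{≤ m}(H)` of strategies with at most `m` bid-quantity
pairs that are RoI-feasible for the bid history `H` over rounds `1,…,T`. -/
def InFeasClass (M : ℕ) (v : ℕ → ℝ) (K T : ℕ) (H : ℕ → Profile K) (m : ℕ) (s : Uniform) : Prop :=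
  s.IsUniform M ∧ s.m ≤ m ∧ ∀ t ∈ Finset.Icc 1 T, Feasible v K s.toBidVec (H t)

/-- Total value obtained by strategy `s` over the bid history `H` on rounds `1,…,T`. -/
noncomputable def totalValue (v : ℕ → ℝ) (K T : ℕ) (H : ℕ → Profile K) (s : Uniform) : ℝ :=
  ∑ t ∈ Finset.Icc 1 T, value v K s.toBidVec (H t)

/-- The optimal total value over the class `𝒫*_{≤ m}`. -/
noncomputable def bestSafe (M : ℕ) (v : ℕ → ℝ) (K T : ℕ) (H : ℕ → Profile K) (m : ℕ) : ℝ :=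
  sSup {x : ℝ | ∃ s : Uniform, InSafeClass M v m s ∧ x = totalValue v K T H s}

/-- The optimal total value over the class `𝒬_{≤ m}(H)`. -/
noncomputable def bestFeas (M : ℕ) (v : ℕ → ℝ) (K T : ℕ) (H : ℕ → Profile K) (m : ℕ) : ℝ :=
  sSup {x : ℝ | ∃ s : Uniform, InFeasClass M v K T H m s ∧ x = totalValue v K T H s}

theorem alloc_le_min (K : ℕ) (b : BidVec) (β : Profile K) : alloc K b β ≤ min b.n K :=
  Finset.sup_le fun _ hr => (Finset.mem_Icc.1 ((@Finset.mem_filter _ _ (_) _ _).1 hr).1).2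

theorem le_alloc {K : ℕ} {b : BidVec} {β : Profile K} {r : ℕ} (hr : r ≤ min b.n K)
    (h : ∀ i ∈ Finset.Icc 1 r, β.c i ≤ b.bid i) : r ≤ alloc K b β := by
  rcases Nat.eq_zero_or_pos r with rfl | hpos
  · exact Nat.zero_le _
  · exact Finset.le_sup (f := id)
      ((@Finset.mem_filter _ _ (_) _ _).2 ⟨Finset.mem_Icc.2 ⟨hpos, hr⟩, h⟩)

theorem threshold_le_bid {K : ℕ} {b : BidVec} {β : Profile K} {i : ℕ} (hi : 1 ≤ i)
    (hia : i ≤ alloc K b β) : β.c i ≤ b.bid i := by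
  obtain ⟨r, hr, hir⟩ := (Finset.le_sup_iff (f := id) (a := i) hi).1 hia
  exact ((@Finset.mem_filter _ _ (_) _ _).1 hr).2 i (Finset.mem_Icc.2 ⟨hi, hir⟩)

theorem bid_lt_threshold {K : ℕ} {b : BidVec} {β : Profile K}
    (h : alloc K b β < min b.n K) : b.bid (alloc K b β + 1) < β.c (alloc K b β + 1) := by
  by_contra! hle
  have : alloc K b β + 1 ≤ alloc K b β := le_alloc h fun i hi => by
    obtain ⟨h1, h2⟩ := Finset.mem_Icc.1 hi
    rcases h2.lt_or_eq with h2 | rfl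
    · exact threshold_le_bid h1 (Nat.lt_succ_iff.1 h2)
    · exact hle
  omega

theorem threshold_le_price {K : ℕ} {b : BidVec} {β : Profile K} (h : 1 ≤ alloc K b β) :
    β.c (alloc K b β) ≤ price K b β := by
  have hK := (alloc_le_min K b β).trans (min_le_right _ _)
  have hbid := threshold_le_bid h le_rfl
  unfold price
  rw [if_neg (by omega)]
  split_ifs with hlt
  · exact le_min hbid (β.mono _ _ h (Nat.le_succ _) hlt)
  · rwa [show alloc K b β = K by omega] at hbid ⊢

theorem Feasible.price_le_w {v : ℕ → ℝ} {K : ℕ} {b : BidVec} {β : Profile K}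
    (hf : Feasible v K b β) (h : 1 ≤ alloc K b β) : price K b β ≤ w v (alloc K b β) :=
  (le_div_iff₀ (by exact_mod_cast h)).2 hf

theorem Uniform.Q_mono (s : Uniform) : Monotone s.Q := fun _ _ h =>
  Finset.sum_le_sum_of_subset (Finset.Icc_subset_Icc_right h)

theorem Uniform.bid_eq (s : Uniform) {j k : ℕ} (h1 : s.Q (j - 1) < k) (h2 : k ≤ s.Q j) :
    s.toBidVec.bid k = s.b j := by
  have h : IsLeast {ℓ : ℕ | k ≤ s.Q ℓ} j := ⟨h2, fun ℓ (hℓ : k ≤ s.Q ℓ) => by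
    by_contra! hlt
    have := s.Q_mono (show ℓ ≤ j - 1 by omega)
    omega⟩
  exact congrArg s.b h.csInf_eq

theorem single_n (x : ℝ) (q : ℕ) : (single x q).toBidVec.n = q := by
  simp [single, Uniform.toBidVec, Uniform.Q]

theorem le_alloc_single {K : ℕ} {β : Profile K} {x : ℝ} {q k : ℕ} (hq : k ≤ q) (hK : k ≤ K)
    (hc : β.c k ≤ x) : k ≤ alloc K (single x q).toBidVec β :=
  le_alloc (by rw [single_n]; exact le_min hq hK) fun i hi => by
    obtain ⟨h1, h2⟩ := Finset.mem_Icc.1 hi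
    exact (β.mono i k h1 h2 hK).trans hc

theorem le_value_single {M K : ℕ} {v : ℕ → ℝ} (hv : ValidValuation M v) {β : Profile K}
    {x : ℝ} {q k : ℕ} (hkq : k ≤ q) (hq : q ≤ M) (hK : k ≤ K) (hc : β.c k ≤ x) :
    ∑ i ∈ Finset.Icc 1 k, v i ≤ value v K (single x q).toBidVec β := by
  have hle := (alloc_le_min K (single x q).toBidVec β).trans (min_le_left _ _)
  rw [single_n] at hle
  refine Finset.sum_le_sum_of_subset_of_nonneg
    (Finset.Icc_subset_Icc_right (le_alloc_single hkq hK hc)) fun i hi _ => ?_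
  obtain ⟨h1, h2⟩ := Finset.mem_Icc.1 hi
  exact hv.1 i h1 (by omega)

theorem value_single_nonneg {M K : ℕ} {v : ℕ → ℝ} (hv : ValidValuation M v) (β : Profile K)
    (x : ℝ) {q : ℕ} (hq : q ≤ M) : 0 ≤ value v K (single x q).toBidVec β := by
  have hle := (alloc_le_min K (single x q).toBidVec β).trans (min_le_left _ _)
  rw [single_n] at hle
  refine Finset.sum_nonneg fun i hi => ?_
  obtain ⟨h1, h2⟩ := Finset.mem_Icc.1 hi
  exact hv.1 i h1 (by omega)

/-- Winning strictly between two consecutive cumulative quantities makes the bidder's own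
bid the clearing price, so RoI-feasibility bounds that bid. -/
theorem Uniform.bid_le_w {v : ℕ → ℝ} {K : ℕ} {s : Uniform} {β : Profile K} {j : ℕ}
    (hf : Feasible v K s.toBidVec β) (hjm : j ≤ s.m) (hK : s.Q j ≤ K)
    (h1 : s.Q (j - 1) < alloc K s.toBidVec β) (h2 : alloc K s.toBidVec β < s.Q j) :
    s.b j ≤ w v (alloc K s.toBidVec β) := by
  refine le_trans ?_ (hf.price_le_w (by omega))
  have hn : s.Q j ≤ s.toBidVec.n := s.Q_mono hjm
  have hlt := bid_lt_threshold (K := K) (b := s.toBidVec) (β := β)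
    (lt_min (by omega) (by omega))
  rw [s.bid_eq (j := j) (by omega) h2] at hlt
  unfold price
  rw [if_neg (by omega), if_pos (by omega), s.bid_eq h1 h2.le]
  exact le_min le_rfl hlt.le

/-- Lemma `lem:value_restricted`: value lower bounds for the
restricted safe strategies `(w Q̂_j, Q̂_j)` and `(w Q*_j, Q*_j)` over the rounds
`T_j = T_{j,0} ∪ T_{j,1}`. -/
theorem value_restricted
    (K M T : ℕ) (v : ℕ → ℝ) (hv : ValidValuation M v) (hMK : M ≤ K)
    (s : Uniform) (hs : s.IsUniform M) (H : ℕ → Profile K)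
    (hfeas : ∀ t ∈ Finset.Icc 1 T, Feasible v K s.toBidVec (H t))
    (j : ℕ) (hj1 : 1 ≤ j) (hjm : j ≤ s.m)
    (Tj0 Tj1 : Finset ℕ) (Qhat : ℕ)
    (hTj0 : Tj0 = (Finset.Icc 1 T).filter
      (fun t => s.Q (j - 1) < alloc K s.toBidVec (H t) ∧ alloc K s.toBidVec (H t) < s.Q j))
    (hTj1 : Tj1 = (Finset.Icc 1 T).filter
      (fun t => alloc K s.toBidVec (H t) = s.Q j))
    (hQhat : Qhat = if Tj0 = ∅ then s.Q j else Tj0.sup (fun t => alloc K s.toBidVec (H t))) :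
    (Qhat < s.Q j →
      (∑ t ∈ Tj0, value v K s.toBidVec (H t)) +
          (∑ i ∈ Finset.Icc 1 Qhat, v i) * (Tj1.card : ℝ) ≤
        ∑ t ∈ Tj0 ∪ Tj1, value v K (single (w v Qhat) Qhat).toBidVec (H t)) ∧
    ((∑ i ∈ Finset.Icc 1 (s.Q j), v i) * (Tj1.card : ℝ) ≤
      ∑ t ∈ Tj0 ∪ Tj1, value v K (single (w v (s.Q j)) (s.Q j)).toBidVec (H t)) := by
  have hQM : s.Q j ≤ M := (s.Q_mono hjm).trans hs.2.2.2.2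
  have hQK : s.Q j ≤ K := hQM.trans hMK
  have hQlt : s.Q (j - 1) < s.Q j := by
    obtain ⟨k, rfl⟩ : ∃ k, j = k + 1 := ⟨j - 1, by omega⟩
    have := hs.2.1 (k + 1) hj1 hjm
    simp only [Uniform.Q, Nat.add_sub_cancel]
    rw [Finset.sum_Icc_succ_top (by omega)]
    omega
  have hmem0 : ∀ t ∈ Tj0, t ∈ Finset.Icc 1 T ∧
      s.Q (j - 1) < alloc K s.toBidVec (H t) ∧ alloc K s.toBidVec (H t) < s.Q j :=
    fun t ht => Finset.mem_filter.1 (hTj0 ▸ ht)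
  have hmem1 : ∀ t ∈ Tj1, t ∈ Finset.Icc 1 T ∧ alloc K s.toBidVec (H t) = s.Q j :=
    fun t ht => Finset.mem_filter.1 (hTj1 ▸ ht)
  have hdisj : Disjoint Tj0 Tj1 := Finset.disjoint_left.2 fun t h0 h1 =>
    ((hmem0 t h0).2.2.trans_eq (hmem1 t h1).2.symm).false
  simp only [Finset.sum_union hdisj]
  constructor
  · intro hlt
    have hne : Tj0 ≠ ∅ := fun h => by
      rw [if_pos h] at hQhat
      omega
    rw [if_neg hne] at hQhat
    obtain ⟨t₀, ht₀, hsup⟩ := Finset.exists_mem_eq_sup Tj0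
      (Finset.nonempty_iff_ne_empty.2 hne) (fun t => alloc K s.toBidVec (H t))
    obtain ⟨hT, hlo, hhi⟩ := hmem0 t₀ ht₀
    have hbw : s.b j ≤ w v Qhat := by
      rw [hQhat, hsup]
      exact Uniform.bid_le_w (hfeas t₀ hT) hjm hQK hlo hhi
    have hQpos : 1 ≤ Qhat := by
      rw [hQhat, hsup]
      exact Nat.one_le_of_lt hlo
    refine add_le_add (Finset.sum_le_sum fun t ht => ?_) ?_
    · obtain ⟨-, h1, h2⟩ := hmem0 t ht
      have hle : alloc K s.toBidVec (H t) ≤ Qhat :=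
        hQhat ▸ Finset.le_sup (f := fun t => alloc K s.toBidVec (H t)) ht
      have hc := threshold_le_bid (Nat.one_le_of_lt h1) le_rfl
      rw [s.bid_eq h1 h2.le] at hc
      exact le_value_single hv hle (by omega) (by omega) (hc.trans hbw)
    · rw [mul_comm, ← nsmul_eq_mul]
      refine Finset.card_nsmul_le_sum _ _ _ fun t ht => ?_
      have hall := (hmem1 t ht).2
      have hc := threshold_le_bid (K := K) (b := s.toBidVec) (β := H t)
        (Nat.one_le_of_lt hQlt) hall.ge
      rw [s.bid_eq hQlt le_rfl] at hc
      exact le_value_single hv le_rfl (by omega) (by omega)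
        (((H t).mono _ _ hQpos hlt.le hQK).trans (hc.trans hbw))
  · rw [mul_comm, ← nsmul_eq_mul]
    refine le_add_of_nonneg_of_le
      (Finset.sum_nonneg fun t _ => value_single_nonneg hv _ _ hQM)
      (Finset.card_nsmul_le_sum _ _ _ fun t ht => ?_)
    obtain ⟨hT, hall⟩ := hmem1 t ht
    have hpos : 1 ≤ alloc K s.toBidVec (H t) := by omega
    have hc := threshold_le_price hpos
    have hp := (hfeas t hT).price_le_w hpos
    rw [hall] at hc hp
    exact le_value_single hv le_rfl hQM hQK (hc.trans hp)

end Auction
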